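/- arXiv:cs/0612069 — 2 statements merged into one kernel-verified Lean document; each statement's English description precedes it below -/
import Mathlib

section
/- Every ω-categorical relational structure Γ has a core, i.e., there exists an endomorphism of Γ whose image induces a substructure all of whose endomorphisms are embeddings. -/
open FirstOrder Language Structure

universe u v w

/-- The structure induced on a subset of a relational structure. -/
def Set.inducedStructure (L : Language) [L.IsRelational] {M : Type u} [L.Structure M]
    (s : Set M) : L.Structure s where
  funMap := fun f _ => isEmptyElim f
  RelMap := fun r x => RelMap r fun i => (x i : M)

attribute [instance] Set.inducedStructure

/-- ω-categoricity via Ryll-Nardzewski: the automorphism group is oligomorphic, i.e.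
has finitely many orbits of `n`-tuples for every `n`. -/
def Oligomorphic (L : Language) (M : Type u) [L.Structure M] : Prop :=
  ∀ n : ℕ, ∃ F : Set (Fin n → M), F.Finite ∧
    ∀ t : Fin n → M, ∃ s ∈ F, ∃ α : M ≃[L] M, ∀ i, α (s i) = t i

/-- The age of `M` is contained in the age of `N`: every finite induced substructure of `M`
embeds into `N`. -/
def AgeLE (L : Language) (M : Type u) (N : Type v) [L.Structure M] [L.Structure N] : Prop :=
  ∀ s : Set M, s.Finite → ∃ f : M → N, Set.InjOn f s ∧
    ∀ (n : ℕ) (r : L.Relations n) (x : Fin n → M), (∀ i, x i ∈ s) →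
      (RelMap r x ↔ RelMap r (f ∘ x))

/-- A structure is a core if every endomorphism is an embedding (injective and reflecting
all relations). -/
def IsCore (L : Language) (N : Type u) [L.Structure N] : Prop :=
  ∀ e : N →[L] N, Function.Injective e ∧
    ∀ (n : ℕ) (r : L.Relations n) (x : Fin n → N), RelMap r (⇑e ∘ x) ↔ RelMap r x

/-- A structure is homogeneous if every isomorphism between finite induced substructures
extends to an automorphism. -/
def IsHomogeneous (L : Language) (N : Type u) [L.Structure N] : Prop :=
  ∀ s : Set N, s.Finite → ∀ f : N → N, Set.InjOn f s →
    (∀ (n : ℕ) (r : L.Relations n) (x : Fin n → N), (∀ i, x i ∈ s) →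
      (RelMap r x ↔ RelMap r (f ∘ x))) →
    ∃ α : N ≃[L] N, ∀ a ∈ s, α a = f a

/-- Homomorphic equivalence: homomorphisms exist in both directions. -/
def HomEquiv (L : Language) (M : Type u) (N : Type v) [L.Structure M] [L.Structure N] : Prop :=
  Nonempty (M →[L] N) ∧ Nonempty (N →[L] M)

/-- Existential positive formulas: built from atomic formulas by `∧`, `∨` and `∃`. -/
inductive IsEP {L : Language} {α : Type w} : ∀ {n : ℕ}, L.BoundedFormula α n → Prop
  | equal {n : ℕ} (t₁ t₂ : L.Term (α ⊕ Fin n)) : IsEP (t₁.bdEqual t₂)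
  | rel {n l : ℕ} (R : L.Relations l) (ts : Fin l → L.Term (α ⊕ Fin n)) :
      IsEP (R.boundedFormula ts)
  | inf {n : ℕ} {φ ψ : L.BoundedFormula α n} : IsEP φ → IsEP ψ → IsEP (φ ⊓ ψ)
  | sup {n : ℕ} {φ ψ : L.BoundedFormula α n} : IsEP φ → IsEP ψ → IsEP (φ ⊔ ψ)
  | ex {n : ℕ} {φ : L.BoundedFormula α (n + 1)} : IsEP φ → IsEP φ.ex

/-- Primitive positive formulas: existentially quantified conjunctions of atomic formulas. -/
inductive IsPP {L : Language} {α : Type w} : ∀ {n : ℕ}, L.BoundedFormula α n → Prop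
  | equal {n : ℕ} (t₁ t₂ : L.Term (α ⊕ Fin n)) : IsPP (t₁.bdEqual t₂)
  | rel {n l : ℕ} (R : L.Relations l) (ts : Fin l → L.Term (α ⊕ Fin n)) :
      IsPP (R.boundedFormula ts)
  | inf {n : ℕ} {φ ψ : L.BoundedFormula α n} : IsPP φ → IsPP ψ → IsPP (φ ⊓ ψ)
  | ex {n : ℕ} {φ : L.BoundedFormula α (n + 1)} : IsPP φ → IsPP φ.ex

/-- Universal formulas. -/
inductive IsUniv {L : Language} {α : Type w} : ∀ {n : ℕ}, L.BoundedFormula α n → Prop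
  | of_isQF {n : ℕ} {φ : L.BoundedFormula α n} : φ.IsQF → IsUniv φ
  | all {n : ℕ} {φ : L.BoundedFormula α (n + 1)} : IsUniv φ → IsUniv φ.all

/-- Existential formulas. -/
inductive IsExi {L : Language} {α : Type w} : ∀ {n : ℕ}, L.BoundedFormula α n → Prop
  | of_isQF {n : ℕ} {φ : L.BoundedFormula α n} : φ.IsQF → IsExi φ
  | ex {n : ℕ} {φ : L.BoundedFormula α (n + 1)} : IsExi φ → IsExi φ.ex

/-- `Γ` contains, among its relations, every relation definable by an existential positive
formula. -/
def ContainsEP (L : Language) (M : Type u) [L.Structure M] : Prop :=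
  ∀ (n : ℕ) (φ : L.Formula (Fin n)), IsEP φ →
    ∃ r : L.Relations n, ∀ x : Fin n → M, RelMap r x ↔ φ.Realize x

/-- `Γ` contains, among its relations, every relation definable by a primitive positive
formula. -/
def ContainsPP (L : Language) (M : Type u) [L.Structure M] : Prop :=
  ∀ (n : ℕ) (φ : L.Formula (Fin n)), IsPP φ →
    ∃ r : L.Relations n, ∀ x : Fin n → M, RelMap r x ↔ φ.Realize x

/-- A structure is model-complete if every self-embedding is elementary. -/
def IsModelComplete (L : Language) (M : Type u) [L.Structure M] : Prop :=
  ∀ e : M ↪[L] M, ∀ (n : ℕ) (φ : L.Formula (Fin n)) (x : Fin n → M),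
    φ.Realize x ↔ φ.Realize (⇑e ∘ x)

/-- The universal first-order theory of a structure. -/
def UnivTheory (L : Language) (M : Type u) [L.Structure M] : L.Theory :=
  {σ : L.Sentence | IsUniv σ ∧ M ⊨ σ}

/-- Every positive atomic fact that holds after applying `c` also holds after applying `d`. -/
def PositiveDiagramLE {L : Language} {M : Type u} [L.Structure M] (c d : M →[L] M) : Prop :=
  (∀ x y : M, c x = c y → d x = d y) ∧
    ∀ (n : ℕ) (r : L.Relations n) (x : Fin n → M), RelMap r (c ∘ x) → RelMap r (d ∘ x)

namespace PositiveDiagramLE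

variable {L : Language} {M : Type u} [L.Structure M]

theorem refl (c : M →[L] M) : PositiveDiagramLE c c :=
  ⟨fun _ _ h => h, fun _ _ _ h => h⟩

theorem trans {c d e : M →[L] M} (hcd : PositiveDiagramLE c d) (hde : PositiveDiagramLE d e) :
    PositiveDiagramLE c e :=
  ⟨fun x y h => hde.1 x y (hcd.1 x y h), fun n r x h => hde.2 n r x (hcd.2 n r x h)⟩

end PositiveDiagramLE

/-- If `n` values of a limit function along an ultrafilter are determined up to automorphisms,
then so is the next one. -/
theorem Oligomorphic.exists_next_value {L : Language} {M : Type u} [L.Structure M]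
    (hM : Oligomorphic L M) {ι : Type w} (U : Ultrafilter ι) (c : ι → M →[L] M) (a : ℕ → M)
    (n : ℕ) (b : ℕ → M) (hb : ∀ᶠ i in U, ∃ α : M ≃[L] M, ∀ j < n, α (c i (a j)) = b j) :
    ∃ m : M, ∀ᶠ i in U, ∃ α : M ≃[L] M,
      ∀ j < n + 1, α (c i (a j)) = Function.update b n m j := by
  obtain ⟨F, hF, hFt⟩ := hM (n + 1)
  have hs : ∀ᶠ i in U, ∃ s ∈ F, ∃ α : M ≃[L] M, ∀ j : Fin (n + 1), α (s j) = c i (a j) :=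
    Filter.Eventually.of_forall fun i => hFt fun j => c i (a j)
  obtain ⟨s, -, hs⟩ := (Ultrafilter.eventually_exists_mem_iff hF).1 hs
  obtain ⟨i₀, ⟨α₀, hα₀⟩, ⟨β₀, hβ₀⟩⟩ := (hb.and hs).exists
  refine ⟨α₀ (c i₀ (a n)), hs.mono ?_⟩
  rintro i ⟨β, hβ⟩
  refine ⟨α₀.comp (β₀.comp β.symm), fun j hj => ?_⟩
  have hmove : (α₀.comp (β₀.comp β.symm)) (c i (a j)) = α₀ (c i₀ (a j)) := by
    have h := hβ ⟨j, hj⟩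
    have h₀ := hβ₀ ⟨j, hj⟩
    simp only at h h₀
    simp [← h, ← h₀]
  rw [hmove]
  rcases Nat.lt_succ_iff_lt_or_eq.1 hj with hjn | rfl
  · rw [Function.update_of_ne hjn.ne, hα₀ j hjn]
  · rw [Function.update_self]

/-- Endomorphisms of a countable oligomorphic structure have limits along ultrafilters, up to
composition with automorphisms. -/
theorem Oligomorphic.exists_ultralimit {L : Language} [L.IsRelational] {M : Type u}
    [L.Structure M] [Countable M] (hM : Oligomorphic L M) {ι : Type w} (U : Ultrafilter ι)
    (c : ι → M →[L] M) :
    ∃ d : M →[L] M, ∀ s : Set M, s.Finite →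
      ∀ᶠ i in U, ∃ α : M ≃[L] M, ∀ x ∈ s, α (c i x) = d x := by
  cases isEmpty_or_nonempty M
  · exact ⟨Hom.id L M, fun s _ => Filter.Eventually.of_forall fun i =>
      ⟨FirstOrder.Language.Equiv.refl L M, fun x => isEmptyElim x⟩⟩
  obtain ⟨a, ha⟩ := exists_surjective_nat M
  let Q (n : ℕ) (b : ℕ → M) : Prop :=
    ∀ᶠ i in U, ∃ α : M ≃[L] M, ∀ j < n, α (c i (a j)) = b j
  choose m hm using hM.exists_next_value U c a
  let B : ∀ n, {b : ℕ → M // Q n b} := fun n =>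
    Nat.rec ⟨a, Filter.Eventually.of_forall fun i => ⟨FirstOrder.Language.Equiv.refl L M, by simp⟩⟩
      (fun n b => ⟨Function.update b.1 n (m n b.1 b.2), hm n b.1 b.2⟩) n
  have hB_succ : ∀ n, (B (n + 1)).1 = Function.update (B n).1 n (m n (B n).1 (B n).2) :=
    fun n => rfl
  have hB : ∀ n j, j < n → (B n).1 j = (B (j + 1)).1 j := by
    intro n j hj
    induction n, hj using Nat.le_induction with
    | base => rfl
    | succ n hn ih => rw [hB_succ n, Function.update_of_ne (Nat.ne_of_lt hn), ih]
  choose k hk using ha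
  let d : M → M := fun x => (B (k x + 1)).1 (k x)
  have hd : ∀ s : Set M, s.Finite → ∀ᶠ i in U, ∃ α : M ≃[L] M, ∀ x ∈ s, α (c i x) = d x := by
    intro s hs
    obtain ⟨n, hn⟩ := (hs.image k).bddAbove
    refine (B (n + 1)).2.mono ?_
    rintro i ⟨α, hα⟩
    refine ⟨α, fun x hx => ?_⟩
    have hx' : k x < n + 1 := Nat.lt_succ_of_le (hn ⟨x, hx, rfl⟩)
    have h := hα (k x) hx'
    rwa [hk, hB _ _ hx'] at h
  refine ⟨⟨d, fun f => isEmptyElim f, fun {n} r x hr => ?_⟩, hd⟩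
  obtain ⟨i, α, hα⟩ := (hd (Set.range x) (Set.finite_range x)).exists
  have hdx : d ∘ x = α ∘ (c i ∘ x) := funext fun j => (hα (x j) ⟨j, rfl⟩).symm
  rw [hdx]
  exact (α.map_rel r _).2 ((c i).map_rel r x hr)

/-- A chain of endomorphisms of a countable oligomorphic structure has an upper bound. -/
theorem Oligomorphic.exists_upperBound {L : Language} [L.IsRelational] {M : Type u}
    [L.Structure M] [Countable M] (hM : Oligomorphic L M) (C : Set (M →[L] M))
    (hC : IsChain PositiveDiagramLE C) :
    ∃ d : M →[L] M, ∀ c ∈ C, PositiveDiagramLE c d := by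
  rcases C.eq_empty_or_nonempty with rfl | hne
  · exact ⟨Hom.id L M, by simp⟩
  let _ : Preorder C :=
    { le := fun c d => PositiveDiagramLE c.1 d.1
      le_refl := fun c => .refl c.1
      le_trans := fun _ _ _ => .trans }
  have : Nonempty C := hne.to_subtype
  have : IsDirectedOrder C := ⟨fun c d => by
    by_cases h : c.1 = d.1
    · exact ⟨c, le_refl c, by rw [Subtype.ext h]⟩
    · rcases hC c.2 d.2 h with h | h
      · exact ⟨d, h, le_refl d⟩
      · exact ⟨c, le_refl c, h⟩⟩
  obtain ⟨d, hd⟩ := hM.exists_ultralimit (Ultrafilter.of (Filter.atTop : Filter C)) (·.1)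
  refine ⟨d, fun c hc => ?_⟩
  have hge : ∀ᶠ i : C in Ultrafilter.of (Filter.atTop : Filter C), PositiveDiagramLE c i.1 :=
    Ultrafilter.of_le _ (Filter.eventually_ge_atTop (⟨c, hc⟩ : C))
  refine ⟨fun x y hxy => ?_, fun n r x hr => ?_⟩
  · obtain ⟨i, hi, α, hα⟩ := (hge.and (hd {x, y} (by simp))).exists
    rw [← hα x (by simp), ← hα y (by simp), hi.1 x y hxy]
  · obtain ⟨i, hi, α, hα⟩ := (hge.and (hd (Set.range x) (Set.finite_range x))).exists
    have hdx : d ∘ x = α ∘ (i.1 ∘ x) := funext fun j => (hα (x j) ⟨j, rfl⟩).symm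
    rw [hdx]
    exact (α.map_rel r _).2 (hi.2 n r x hr)

/-- The image of an endomorphism with maximal positive diagram is a core. -/
theorem isCore_range_of_maximal {L : Language} [L.IsRelational] {M : Type u} [L.Structure M]
    (c : M →[L] M) (hc : ∀ d : M →[L] M, PositiveDiagramLE c d → PositiveDiagramLE d c) :
    IsCore L ↥(Set.range c) := by
  intro e
  let p : M → Set.range c := fun x => ⟨c x, x, rfl⟩
  have hp : ∀ (n : ℕ) (r : L.Relations n) (x : Fin n → M),
      RelMap r (c ∘ x) → RelMap r (fun j => (e (p (x j)) : M)) :=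
    fun n r x hr => e.map_rel r (p ∘ x) hr
  let d : M →[L] M :=
    ⟨fun x => e (p x), fun f => isEmptyElim f, fun r x hr => hp _ r x (c.map_rel r x hr)⟩
  have hdc : PositiveDiagramLE d c :=
    hc d ⟨fun x y h => congrArg (fun z => (e z : M)) (Subtype.ext h), hp⟩
  refine ⟨?_, fun n r x => ⟨fun hr => ?_, e.map_rel r x⟩⟩
  · rintro ⟨_, x, rfl⟩ ⟨_, y, rfl⟩ h
    exact Subtype.ext (hdc.1 x y (congrArg Subtype.val h))
  · choose z hz using fun j => (x j).2
    obtain rfl : x = p ∘ z := funext fun j => Subtype.ext (hz j).symm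
    exact hdc.2 n r z hr

theorem stmt_3 {L : Language} [L.IsRelational] {M : Type u} [L.Structure M] [Countable M]
    (hM : Oligomorphic L M) :
    ∃ c : M →[L] M, IsCore L ↥(Set.range c) := by
  obtain ⟨c, hc⟩ := exists_maximal_of_chains_bounded hM.exists_upperBound
    PositiveDiagramLE.trans
  exact ⟨c, isCore_range_of_maximal c hc⟩
end

section
/- The substructure Γ' of (ℚ⁺, <, ≠, P) induced on ℚ⁺ \ (1,2) (positive rationals without the open interval (1,2)), where P holds everywhere, is a core but is not model-complete: there is a self-embedding of Γ' that is not elementary. -/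
open FirstOrder Language Structure

universe u v w

/-- Relation symbols: a unary `P`, and binary `<` and `≠`. -/
inductive Rel3 : ℕ → Type
  | P : Rel3 1
  | lt : Rel3 2
  | ne : Rel3 2

/-- The language with one unary relation `P` and two binary relations `<` and `≠`. -/
def L3 : Language := ⟨fun _ => Empty, Rel3⟩

instance : L3.IsRelational := fun _ => inferInstanceAs (IsEmpty Empty)
/-- The domain `ℚ⁺ \ (1,2)`: positive rationals without the open interval `(1,2)`. -/
def Qc : Type := {q : ℚ // 0 < q ∧ (q ≤ 1 ∨ 2 ≤ q)}

/-- The structure `Γ'` induced on `ℚ⁺ \ (1,2)`, where `P` holds everywhere. -/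
instance QcStr : L3.Structure Qc where
  funMap := fun f _ => f.elim
  RelMap := fun r x =>
    match r with
    | .P => True
    | .lt => (x 0).1 < (x 1).1
    | .ne => x 0 ≠ x 1

theorem Qc.map_lt (e : Qc →[L3] Qc) {a b : Qc} (h : a.1 < b.1) : (e a).1 < (e b).1 :=
  e.map_rel' (Rel3.lt : L3.Relations 2) ![a, b] h

theorem Qc.map_lt_iff (e : Qc →[L3] Qc) {a b : Qc} : (e a).1 < (e b).1 ↔ a.1 < b.1 := by
  refine ⟨fun h => ?_, Qc.map_lt e⟩
  rcases lt_trichotomy a.1 b.1 with hab | hab | hab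
  · exact hab
  · rw [Subtype.ext hab] at h
    exact (lt_irrefl _ h).elim
  · exact (lt_asymm h (Qc.map_lt e hab)).elim

theorem Qc.map_injective (e : Qc →[L3] Qc) : Function.Injective e := by
  intro a b h
  rcases lt_trichotomy a.1 b.1 with hab | hab | hab
  · exact ((Qc.map_lt e hab).ne (congrArg Subtype.val h)).elim
  · exact Subtype.ext hab
  · exact ((Qc.map_lt e hab).ne (congrArg Subtype.val h.symm)).elim

theorem isCore_Qc : IsCore L3 Qc := by
  refine fun e => ⟨Qc.map_injective e, fun n r x => ?_⟩
  cases r with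
  | P => exact Iff.rfl
  | lt => exact Qc.map_lt_iff e
  | ne => exact (Qc.map_injective e).ne_iff

/-- Translation by `3`, which moves the domain into a densely ordered part of itself. -/
def Qc.shift : Qc ↪[L3] Qc where
  toFun q := ⟨q.1 + 3, by linarith [q.2.1], Or.inr (by linarith [q.2.1])⟩
  inj' a b h := Subtype.ext (add_right_cancel (congrArg Subtype.val h))
  map_fun' := fun f _ => f.elim
  map_rel' := by
    intro n r x
    cases r with
    | P => exact Iff.rfl
    | lt => exact add_lt_add_iff_right 3
    | ne =>
      exact not_congr
        ⟨fun h => Subtype.ext (add_right_cancel (congrArg Subtype.val h)),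
          fun h => Subtype.ext (congrArg (fun q : Qc => q.1 + 3) h)⟩

/-- The formula `∃ z, x < z ∧ z < y`. -/
def betweenFormula : L3.Formula (Fin 2) :=
  (Relations.boundedFormula₂ (Rel3.lt : L3.Relations 2)
      (Term.var (Sum.inl 0)) (Term.var (Sum.inr 0)) ⊓
    Relations.boundedFormula₂ (Rel3.lt : L3.Relations 2)
      (Term.var (Sum.inr 0)) (Term.var (Sum.inl 1)) :
    L3.BoundedFormula (Fin 2) 1).ex

theorem realize_betweenFormula (x : Fin 2 → Qc) :
    betweenFormula.Realize x ↔ ∃ z : Qc, (x 0).1 < z.1 ∧ z.1 < (x 1).1 := by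
  unfold betweenFormula Formula.Realize
  rw [BoundedFormula.realize_ex]
  exact exists_congr fun z => BoundedFormula.realize_inf.trans Iff.rfl

theorem stmt_5 :
    IsCore L3 Qc ∧
      ∃ e : Qc ↪[L3] Qc,
        ¬ ∀ (n : ℕ) (φ : L3.Formula (Fin n)) (x : Fin n → Qc),
            φ.Realize x ↔ φ.Realize (⇑e ∘ x) := by
  refine ⟨isCore_Qc, Qc.shift, fun h => ?_⟩
  have hx := h 2 betweenFormula
    ![⟨1, one_pos, Or.inl le_rfl⟩, ⟨2, two_pos, Or.inr le_rfl⟩]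
  rw [realize_betweenFormula, realize_betweenFormula] at hx
  obtain ⟨⟨z, hz, hz'⟩, h1, h2⟩ := hx.2
    ⟨⟨9 / 2, by norm_num, by norm_num⟩, show (1 : ℚ) + 3 < 9 / 2 by norm_num,
      show (9 / 2 : ℚ) < 2 + 3 by norm_num⟩
  exact hz'.elim (not_le_of_gt h1) (not_le_of_gt h2)
end
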